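/- arXiv:2603.28349 — 3 statements merged into one kernel-verified Lean document; each statement's English description precedes it below -/
import Mathlib

section
/- Let A be an MPS tensor admitting a one-site left inverse A^{-1}, i.e., a family A^{-1} : Fin d → Matrix (Fin D) (Fin D) ℂ with Σ_{i ∈ Fin d} (A^{-1})^i_{γδ} (A^i)_{αβ} = δ_{γα} δ_{δβ} for all α, β, γ, δ. Let o be a 2-site operator, ε ∈ ℂ, and let B : Fin d → Matrix (Fin D) (Fin D) ℂ satisfy the local telescoping equation for (A, o, ε) (case k = 2). Define the d×d matrix T by T_{l,j} := Σ_{α,β} B^l_{αβ} (A^{-1})^j_{αβ}, and let T_n denote T acting on site n of (ℂ^d)^{⊗N}. Then for every N ≥ 3, every site a, and every 1 ≤ m ≤ N − 1, the action of the truncated operator sum on the matrix product state ψ_N is a pure boundary term: ( Σ_{n=a}^{a+m−1} o_n − m·ε ) ψ_N = T_{a+m} ψ_N − T_a ψ_N (all site indices mod N). -/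
open Matrix
open scoped ComplexOrder

/-- Cyclic shift of a site index: `cyc a t` is `a + t (mod N)`. -/
def cyc {N : ℕ} (a : Fin N) (t : ℕ) : Fin N :=
  ⟨(a.val + t) % N, Nat.mod_lt _ (Nat.lt_of_le_of_lt (Nat.zero_le _) a.isLt)⟩

/-- Ordered product `A^{i_1} ⋯ A^{i_m}`. -/
noncomputable def prodA {d D m : ℕ} (A : Fin d → Matrix (Fin D) (Fin D) ℂ)
    (i : Fin m → Fin d) : Matrix (Fin D) (Fin D) ℂ :=
  (List.ofFn fun t => A (i t)).prod

/-- Matrix product state on `N` cyclic sites: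
`ψ_N(i_1,…,i_N) = Tr(A^{i_1} ⋯ A^{i_N})`. -/
noncomputable def mps {d D : ℕ} (A : Fin d → Matrix (Fin D) (Fin D) ℂ) (N : ℕ) :
    (Fin N → Fin d) → ℂ :=
  fun i => (prodA A i).trace

/-- A `k`-site operator `o` acting on sites `n, n+1, …, n+k-1 (mod N)` of a
periodic chain of `N` sites, as a matrix on the full configuration space. -/
noncomputable def localOp {d k N : ℕ}
    (o : Matrix (Fin k → Fin d) (Fin k → Fin d) ℂ) (n : Fin N) :
    Matrix (Fin N → Fin d) (Fin N → Fin d) ℂ :=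
  Matrix.of fun x y =>
    o (fun t => x (cyc n t.val)) (fun t => y (cyc n t.val)) *
      (if ∀ m : Fin N, (∀ t : Fin k, m ≠ cyc n t.val) → x m = y m then 1 else 0)

/-- `O_N = Σ_{n=1}^N o_n`, the sum of all translates of a `k`-site operator. -/
noncomputable def opSum {d k N : ℕ}
    (o : Matrix (Fin k → Fin d) (Fin k → Fin d) ℂ) :
    Matrix (Fin N → Fin d) (Fin N → Fin d) ℂ :=
  ∑ n : Fin N, localOp o n

/-- `A` is injective with injectivity length `L`: the map
`Γ_L : X ↦ (Tr(X A^{i_1} ⋯ A^{i_L}))_{i}` is injective. -/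
noncomputable def InjectiveLen {d D : ℕ} (A : Fin d → Matrix (Fin D) (Fin D) ℂ)
    (L : ℕ) : Prop :=
  Function.Injective fun X : Matrix (Fin D) (Fin D) ℂ =>
    fun i : Fin L → Fin d => (X * prodA A i).trace

/-- `ρL, ρR` are positive definite fixed points of the transfer operator of `A`. -/
def TransferFixedPoints {d D : ℕ} (A : Fin d → Matrix (Fin D) (Fin D) ℂ)
    (ρL ρR : Matrix (Fin D) (Fin D) ℂ) : Prop :=
  ρL.PosDef ∧ ρR.PosDef ∧
    (∑ i, (A i)ᴴ * ρL * A i) = ρL ∧ (∑ i, A i * ρR * (A i)ᴴ) = ρR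

/-- `B` satisfies the local telescoping equation for `(A, o, ε)`, where `o` is a
`(k+1)`-site operator and `B` is a family of matrices indexed by `k`-tuples:
`Σ_j o^{i}_{j} A^{j_0}⋯A^{j_k} − ε A^{i_0}⋯A^{i_k}
  = A^{i_0} B^{i_1…i_k} − B^{i_0…i_{k-1}} A^{i_k}`. -/
noncomputable def Telescopes {d D k : ℕ} (A : Fin d → Matrix (Fin D) (Fin D) ℂ)
    (o : Matrix (Fin (k+1) → Fin d) (Fin (k+1) → Fin d) ℂ) (ε : ℂ)
    (B : (Fin k → Fin d) → Matrix (Fin D) (Fin D) ℂ) : Prop :=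
  ∀ i : Fin (k+1) → Fin d,
    (∑ j : Fin (k+1) → Fin d, o i j • prodA A j) - ε • prodA A i
      = A (i 0) * B (fun t => i t.succ) - B (fun t => i t.castSucc) * A (i (Fin.last k))

/-- A one-site operator `T` acting on site `n` of a periodic chain of `N` sites. -/
noncomputable def oneSiteOp {d N : ℕ} (T : Matrix (Fin d) (Fin d) ℂ) (n : Fin N) :
    Matrix (Fin N → Fin d) (Fin N → Fin d) ℂ :=
  Matrix.of fun x y =>
    T (x n) (y n) * (if ∀ m : Fin N, m ≠ n → x m = y m then 1 else 0)

theorem trace_list_prod_rotate {D : ℕ} (l : List (Matrix (Fin D) (Fin D) ℂ)) (k : ℕ) :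
    (l.rotate k).prod.trace = l.prod.trace := by
  induction k generalizing l with
  | zero => simp
  | succ k ih =>
    cases l with
    | nil => simp
    | cons M l =>
      rw [List.rotate_cons_succ, ih, List.prod_append, List.prod_singleton, List.prod_cons,
        Matrix.trace_mul_comm]

theorem ofFn_comp_cyc {α : Type*} {N : ℕ} (f : Fin N → α) (n : Fin N) :
    (List.ofFn fun t : Fin N => f (cyc n t)) = (List.ofFn f).rotate n := by
  refine List.ext_getElem (by simp) fun k _ _ => ?_
  simp [List.getElem_rotate, cyc, add_comm]

theorem cyc_zero {N : ℕ} (a : Fin N) : cyc a 0 = a := by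
  ext
  simp [cyc, Nat.mod_eq_of_lt a.isLt]

theorem cyc_cyc {N : ℕ} (a : Fin N) (s t : ℕ) : cyc (cyc a s) t = cyc a (s + t) := by
  ext
  simp [cyc, add_assoc]

theorem cyc_injOn {N : ℕ} (a : Fin N) {s t : ℕ} (hs : s < N) (ht : t < N)
    (h : cyc a s = cyc a t) : s = t := by
  have h' : a.val + s ≡ a.val + t [MOD N] := congrArg Fin.val h
  exact (Nat.ModEq.add_left_cancel' _ h').eq_of_lt_of_lt hs ht

/-- The matrix product over all sites other than `n` and `n + 1`, in cyclic order. -/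
noncomputable def environment {d D K : ℕ} (A : Fin d → Matrix (Fin D) (Fin D) ℂ)
    (n : Fin (K + 2)) (x : Fin (K + 2) → Fin d) : Matrix (Fin D) (Fin D) ℂ :=
  (List.ofFn fun t : Fin K => A (x (cyc n (t + 2)))).prod

theorem mps_eq_trace_mul_environment {d D K : ℕ} (A : Fin d → Matrix (Fin D) (Fin D) ℂ)
    (n : Fin (K + 2)) (x y : Fin (K + 2) → Fin d)
    (h : ∀ m, m ≠ n → m ≠ cyc n 1 → x m = y m) :
    mps A (K + 2) y = (A (y n) * A (y (cyc n 1)) * environment A n x).trace := by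
  have hx : environment A n x = environment A n y := by
    unfold environment
    congr 2
    funext t
    rw [h]
    · intro e
      have := cyc_injOn n (t := 0) (by omega) (by omega) (e.trans (cyc_zero n).symm)
      omega
    · intro e
      have := cyc_injOn n (by omega) (by omega) e
      omega
  rw [hx, mps, prodA, ← trace_list_prod_rotate _ n.val, ← ofFn_comp_cyc (fun t => A (y t)) n]
  simp [List.ofFn_succ, environment, cyc_zero, mul_assoc]

theorem oneSiteOp_mulVec {d N : ℕ} (T : Matrix (Fin d) (Fin d) ℂ) (n : Fin N)
    (ψ : (Fin N → Fin d) → ℂ) (x : Fin N → Fin d) :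
    (oneSiteOp T n).mulVec ψ x = ∑ j, T (x n) j * ψ (Function.update x n j) := by
  simp only [Matrix.mulVec, dotProduct, oneSiteOp, Matrix.of_apply, mul_ite, mul_one, mul_zero,
    ite_mul, zero_mul]
  rw [← Finset.sum_filter]
  refine Finset.sum_nbij' (fun y => y n) (fun j => Function.update x n j) (by simp) ?_ ?_
    (by simp) ?_
  · intro j _
    simp +contextual
  all_goals
    intro y hy
    have hy' : Function.update x n (y n) = y := by
      simp only [Finset.mem_filter, Finset.mem_univ, true_and] at hy
      funext m
      by_cases hm : m = n
      · subst hm; simp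
      · simp [hm, hy m hm]
    simp [hy']

theorem localOp_two_mulVec {d N : ℕ} (o : Matrix (Fin 2 → Fin d) (Fin 2 → Fin d) ℂ) (n : Fin N)
    (hn : n ≠ cyc n 1) (ψ : (Fin N → Fin d) → ℂ) (x : Fin N → Fin d) :
    (localOp o n).mulVec ψ x = ∑ j₁, ∑ j₂, o ![x n, x (cyc n 1)] ![j₁, j₂] *
      ψ (Function.update (Function.update x n j₁) (cyc n 1) j₂) := by
  have pair (y : Fin N → Fin d) :
      (fun t : Fin 2 => y (cyc n t.val)) = ![y n, y (cyc n 1)] := by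
    funext t
    fin_cases t <;> simp [cyc_zero]
  simp only [Matrix.mulVec, dotProduct, localOp, Matrix.of_apply, mul_ite, mul_one, mul_zero,
    ite_mul, zero_mul, pair, Fin.forall_fin_two, Fin.val_zero, Fin.val_one, cyc_zero]
  rw [← Finset.sum_filter, ← Fintype.sum_prod_type' (f := fun j₁ j₂ =>
    o ![x n, x (cyc n 1)] ![j₁, j₂] *
      ψ (Function.update (Function.update x n j₁) (cyc n 1) j₂))]
  refine Finset.sum_nbij' (fun y => (y n, y (cyc n 1)))
    (fun j => Function.update (Function.update x n j.1) (cyc n 1) j.2) (by simp) ?_ ?_ ?_ ?_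
  · intro j _
    simp +contextual
  · intro y hy
    simp only [Finset.mem_filter, Finset.mem_univ, true_and] at hy
    funext m
    by_cases hm₁ : m = cyc n 1
    · subst hm₁; simp
    · by_cases hm : m = n
      · subst hm; simp [hn]
      · simp [hm, hm₁, hy m ⟨hm, hm₁⟩]
  · intro j _
    simp [hn]
  · intro y hy
    simp only [Finset.mem_filter, Finset.mem_univ, true_and] at hy
    congr 2
    funext m
    by_cases hm₁ : m = cyc n 1
    · subst hm₁; simp
    · by_cases hm : m = n
      · subst hm; simp [hn]
      · simp [hm, hm₁, hy m ⟨hm, hm₁⟩]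

theorem sum_smul_eq_of_left_inverse {d D : ℕ} {A Ainv B : Fin d → Matrix (Fin D) (Fin D) ℂ}
    (hAinv : ∀ α β γ δ : Fin D,
      (∑ i : Fin d, Ainv i γ δ * A i α β)
        = (if γ = α then (1:ℂ) else 0) * (if δ = β then (1:ℂ) else 0))
    {T : Matrix (Fin d) (Fin d) ℂ}
    (hT : ∀ l j : Fin d, T l j = ∑ α : Fin D, ∑ β : Fin D, B l α β * Ainv j α β) (l : Fin d) :
    ∑ j, T l j • A j = B l := by
  ext α β
  simp only [Matrix.sum_apply, Matrix.smul_apply, smul_eq_mul, hT, Finset.sum_mul, mul_assoc]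
  rw [Finset.sum_comm]
  simp_rw [Finset.sum_comm (s := (Finset.univ : Finset (Fin d))), ← Finset.mul_sum, hAinv]
  simp

/-- A single local term acts on the matrix product state as a difference of one-site terms. -/
theorem localOp_mulVec_mps_sub {d D K : ℕ} {A B : Fin d → Matrix (Fin D) (Fin D) ℂ}
    {o : Matrix (Fin 2 → Fin d) (Fin 2 → Fin d) ℂ} {ε : ℂ}
    (hB : ∀ i1 i2 : Fin d,
      (∑ j1 : Fin d, ∑ j2 : Fin d, o ![i1, i2] ![j1, j2] • (A j1 * A j2))
          - ε • (A i1 * A i2)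
        = A i1 * B i2 - B i1 * A i2)
    {T : Matrix (Fin d) (Fin d) ℂ} (hTB : ∀ l, ∑ j, T l j • A j = B l) (n : Fin (K + 2)) :
    (localOp o n).mulVec (mps A (K + 2)) - ε • mps A (K + 2)
      = (oneSiteOp T (cyc n 1)).mulVec (mps A (K + 2))
        - (oneSiteOp T n).mulVec (mps A (K + 2)) := by
  have hn : n ≠ cyc n 1 := fun e => by
    have := cyc_injOn n (s := 0) (by omega) (by omega) ((cyc_zero n).trans e)
    omega
  funext x
  have key (y : Fin (K + 2) → Fin d) (h : ∀ m, m ≠ n → m ≠ cyc n 1 → x m = y m) :=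
    mps_eq_trace_mul_environment A n x y h
  have h₁ (j : Fin d) : mps A (K + 2) (Function.update x n j)
      = (A j * A (x (cyc n 1)) * environment A n x).trace := by
    rw [key _ (by simp +contextual)]
    simp [hn.symm]
  have h₂ (j : Fin d) : mps A (K + 2) (Function.update x (cyc n 1) j)
      = (A (x n) * A j * environment A n x).trace := by
    rw [key _ (by simp +contextual)]
    simp [hn]
  have h₃ (j₁ j₂ : Fin d) :
      mps A (K + 2) (Function.update (Function.update x n j₁) (cyc n 1) j₂)
      = (A j₁ * A j₂ * environment A n x).trace := by
    rw [key _ (by simp +contextual)]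
    simp [hn]
  simp only [Pi.sub_apply, Pi.smul_apply, localOp_two_mulVec o n hn, oneSiteOp_mulVec, h₁, h₂, h₃,
    key x (fun _ _ _ => rfl)]
  have := congrArg (fun M => (M * environment A n x).trace) (hB (x n) (x (cyc n 1)))
  simpa [← hTB, sub_mul, Finset.sum_mul, Finset.mul_sum, Matrix.trace_sum] using this

/-- Suppose `A` has a one-site left inverse `Ainv`, and `B`
satisfies the local telescoping equation for a 2-site operator `o` and `ε`.
With `T_{l,j} = Σ_{α,β} B^l_{αβ} (A^{-1})^j_{αβ}`, for every `N ≥ 3`, every site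
`a` and every `1 ≤ m ≤ N−1`, the truncated operator sum acts on `ψ_N` as a pure
boundary term: `(Σ_{n=a}^{a+m-1} o_n − m ε) ψ_N = T_{a+m} ψ_N − T_a ψ_N`. -/
theorem truncated_sum_is_boundary_term
    (d D : ℕ) (hd : 1 ≤ d) (hD : 1 ≤ D)
    (A Ainv : Fin d → Matrix (Fin D) (Fin D) ℂ)
    (hAinv : ∀ α β γ δ : Fin D,
      (∑ i : Fin d, Ainv i γ δ * A i α β)
        = (if γ = α then (1:ℂ) else 0) * (if δ = β then (1:ℂ) else 0))
    (o : Matrix (Fin 2 → Fin d) (Fin 2 → Fin d) ℂ) (ε : ℂ)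
    (B : Fin d → Matrix (Fin D) (Fin D) ℂ)
    (hB : ∀ i1 i2 : Fin d,
      (∑ j1 : Fin d, ∑ j2 : Fin d, o ![i1, i2] ![j1, j2] • (A j1 * A j2))
          - ε • (A i1 * A i2)
        = A i1 * B i2 - B i1 * A i2)
    (T : Matrix (Fin d) (Fin d) ℂ)
    (hT : ∀ l j : Fin d, T l j = ∑ α : Fin D, ∑ β : Fin D, B l α β * Ainv j α β) :
    ∀ N : ℕ, 3 ≤ N → ∀ a : Fin N, ∀ m : ℕ, 1 ≤ m → m ≤ N - 1 →
      (∑ t ∈ Finset.range m, localOp o (cyc a t)).mulVec (mps A N)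
          - ((m : ℂ) * ε) • mps A N
        = (oneSiteOp T (cyc a m)).mulVec (mps A N)
          - (oneSiteOp T a).mulVec (mps A N) := by
  intro N hN a m _ _
  obtain ⟨K, rfl⟩ : ∃ K, N = K + 2 := ⟨N - 2, by omega⟩
  have step := localOp_mulVec_mps_sub (K := K) hB (sum_smul_eq_of_left_inverse hAinv hT)
  have tele := Finset.sum_range_sub (fun t => (oneSiteOp T (cyc a t)).mulVec (mps A (K + 2))) m
  simp only [cyc_zero, ← cyc_cyc, ← step] at tele
  rw [← tele, Finset.sum_sub_distrib, Matrix.sum_mulVec, Finset.sum_const, Finset.card_range,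
    mul_smul, Nat.cast_smul_eq_nsmul]
end

section
/- Let d ≥ 1 and let O be a linear endomorphism of ℂ^d ⊗ ℂ^d. Suppose that for some N ≥ 6 the sum of all its translates on a periodic chain of N sites vanishes: Σ_{n=1}^N O_{n,n+1} = 0 as an operator on (ℂ^d)^{⊗N}, where O_{n,n+1} denotes O acting on sites n and n+1 (mod N). Then there exists a linear endomorphism Q of ℂ^d such that O = Q ⊗ Id − Id ⊗ Q. -/
open Matrix
open scoped ComplexOrder

/-- The configuration on `N` sites equal to `x` on the sites `0, 1` and to `e` elsewhere. -/
def padPair {d : ℕ} (N : ℕ) (e : Fin d) (x : Fin 2 → Fin d) (m : Fin N) : Fin d :=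
  if m.val = 0 then x 0 else if m.val = 1 then x 1 else e

lemma localOp_two_apply {d N : ℕ} (O : Matrix (Fin 2 → Fin d) (Fin 2 → Fin d) ℂ) (n : Fin N)
    (X Y : Fin N → Fin d) :
    localOp O n X Y = O ![X (cyc n 0), X (cyc n 1)] ![Y (cyc n 0), Y (cyc n 1)] *
      (if ∀ m : Fin N, m ≠ cyc n 0 → m ≠ cyc n 1 → X m = Y m then 1 else 0) := by
  have h (Z : Fin N → Fin d) :
      (fun t : Fin 2 => Z (cyc n t.val)) = ![Z (cyc n 0), Z (cyc n 1)] := by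
    ext t; fin_cases t <;> rfl
  simp only [localOp, of_apply, h, Fin.forall_fin_two, Fin.val_zero, Fin.val_one, and_imp]

section padPair

variable {d N : ℕ} (O : Matrix (Fin 2 → Fin d) (Fin 2 → Fin d) ℂ) (e : Fin d)
  (x y : Fin 2 → Fin d) (n : Fin N)

lemma localOp_padPair_of_eq_zero (hN : 3 ≤ N) (hn : n.val = 0) :
    localOp O n (padPair N e x) (padPair N e y) = O x y := by
  have h0 : (cyc n 0).val = 0 := by simp [cyc, hn]
  have h1 : (cyc n 1).val = 1 := by simp [cyc, hn, Nat.mod_eq_of_lt (show 1 < N by omega)]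
  have h (z : Fin 2 → Fin d) : ![z 0, z 1] = z := by ext t; fin_cases t <;> rfl
  have hc : ∀ m : Fin N, m ≠ cyc n 0 → m ≠ cyc n 1 → padPair N e x m = padPair N e y m := by
    intro m hm0 hm1
    rw [ne_eq, Fin.ext_iff] at hm0 hm1
    rw [h0] at hm0
    rw [h1] at hm1
    simp [padPair, hm0, hm1]
  rw [localOp_two_apply, if_pos hc]
  simp [padPair, h0, h1, h]

lemma localOp_padPair_of_eq_one (hN : 3 ≤ N) (hn : n.val = 1) :
    localOp O n (padPair N e x) (padPair N e y) =
      O ![x 1, e] ![y 1, e] * (if x 0 = y 0 then 1 else 0) := by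
  have h0 : (cyc n 0).val = 1 := by simp [cyc, hn, Nat.mod_eq_of_lt (show 1 < N by omega)]
  have h1 : (cyc n 1).val = 2 := by simp [cyc, hn, Nat.mod_eq_of_lt (show 2 < N by omega)]
  have hc : (∀ m : Fin N, m ≠ cyc n 0 → m ≠ cyc n 1 → padPair N e x m = padPair N e y m) ↔
      x 0 = y 0 := by
    simp only [ne_eq, Fin.ext_iff, h0, h1]
    refine ⟨fun h => ?_, fun h m hm _ => ?_⟩
    · simpa [padPair] using h ⟨0, by omega⟩
    · simp [padPair, hm, Fin.ext h]
  rw [localOp_two_apply]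
  simp only [hc]
  simp [padPair, h0, h1]

lemma localOp_padPair_of_succ_eq (hN : 3 ≤ N) (hn : n.val + 1 = N) :
    localOp O n (padPair N e x) (padPair N e y) =
      O ![e, x 0] ![e, y 0] * (if x 1 = y 1 then 1 else 0) := by
  have h0 : (cyc n 0).val = N - 1 := by
    simp only [cyc, add_zero, Nat.mod_eq_of_lt n.isLt]; omega
  have h1 : (cyc n 1).val = 0 := by simp [cyc, hn]
  have hc : (∀ m : Fin N, m ≠ cyc n 0 → m ≠ cyc n 1 → padPair N e x m = padPair N e y m) ↔
      x 1 = y 1 := by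
    simp only [ne_eq, Fin.ext_iff, h0, h1]
    refine ⟨fun h => ?_, fun h m _ hm => ?_⟩
    · simpa [padPair] using h ⟨1, by omega⟩ (by simp only; omega) (by simp)
    · simp [padPair, hm, Fin.ext h]
  rw [localOp_two_apply]
  simp only [hc]
  simp [padPair, h0, h1, show N - 1 ≠ 0 by omega, show N - 1 ≠ 1 by omega]

lemma localOp_padPair_of_two_le (hn : 2 ≤ n.val) (hn' : n.val + 1 < N) :
    localOp O n (padPair N e x) (padPair N e y) =
      O ![e, e] ![e, e] * (if x 0 = y 0 ∧ x 1 = y 1 then 1 else 0) := by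
  have h0 : (cyc n 0).val = n.val := by simp [cyc, Nat.mod_eq_of_lt n.isLt]
  have h1 : (cyc n 1).val = n.val + 1 := by simp [cyc, Nat.mod_eq_of_lt hn']
  have hc : (∀ m : Fin N, m ≠ cyc n 0 → m ≠ cyc n 1 → padPair N e x m = padPair N e y m) ↔
      x 0 = y 0 ∧ x 1 = y 1 := by
    simp only [ne_eq, Fin.ext_iff, h0, h1]
    refine ⟨fun h => ⟨?_, ?_⟩, fun h m _ _ => ?_⟩
    · simpa [padPair] using h ⟨0, by omega⟩ (by simp only; omega) (by simp)
    · simpa [padPair] using h ⟨1, by omega⟩ (by simp only; omega) (by simp only; omega)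
    · simp [padPair, Fin.ext h.1, Fin.ext h.2]
  rw [localOp_two_apply]
  simp only [hc]
  simp [padPair, h0, h1, show n.val ≠ 0 by omega, show n.val ≠ 1 by omega]

end padPair

lemma opSum_padPair {d K : ℕ} (O : Matrix (Fin 2 → Fin d) (Fin 2 → Fin d) ℂ) (e : Fin d)
    (x y : Fin 2 → Fin d) :
    opSum (N := K + 3) O (padPair (K + 3) e x) (padPair (K + 3) e y) =
      O x y + O ![x 1, e] ![y 1, e] * (if x 0 = y 0 then 1 else 0)
        + O ![e, x 0] ![e, y 0] * (if x 1 = y 1 then 1 else 0)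
        + K * (O ![e, e] ![e, e] * (if x 0 = y 0 ∧ x 1 = y 1 then 1 else 0)) := by
  have hmid (i : Fin K) : localOp O i.castSucc.succ.succ (padPair (K + 3) e x)
      (padPair (K + 3) e y) =
        O ![e, e] ![e, e] * (if x 0 = y 0 ∧ x 1 = y 1 then 1 else 0) :=
    localOp_padPair_of_two_le O e x y _ (by simp) (by simp)
  rw [opSum, Matrix.sum_apply, Fin.sum_univ_succ, Fin.sum_univ_succ, Fin.sum_univ_castSucc,
    localOp_padPair_of_eq_zero O e x y _ (by omega) rfl,
    localOp_padPair_of_eq_one O e x y _ (by omega) (by simp),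
    localOp_padPair_of_succ_eq O e x y _ (by omega) (by simp)]
  simp only [hmid, Finset.sum_const, Finset.card_univ, Fintype.card_fin, nsmul_eq_mul]
  ring

/-- If the sum of all translates of a 2-site operator `O` on a
periodic chain of `N ≥ 6` sites vanishes, then `O = Q ⊗ Id − Id ⊗ Q` for some
one-site operator `Q`. -/
theorem zero_sum_local_operator_is_telescopic
    (d : ℕ) (hd : 1 ≤ d)
    (O : Matrix (Fin 2 → Fin d) (Fin 2 → Fin d) ℂ)
    (N : ℕ) (hN : 6 ≤ N)
    (hzero : opSum (N := N) O = 0) :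
    ∃ Q : Matrix (Fin d) (Fin d) ℂ, ∀ x y : Fin 2 → Fin d,
      O x y = Q (x 0) (y 0) * (if x 1 = y 1 then (1:ℂ) else 0)
            - (if x 0 = y 0 then (1:ℂ) else 0) * Q (x 1) (y 1) := by
  obtain ⟨K, rfl⟩ : ∃ K, N = K + 3 := ⟨N - 3, by omega⟩
  let e : Fin d := ⟨0, hd⟩
  have key (x y : Fin 2 → Fin d) := opSum_padPair (K := K) O e x y
  simp only [hzero, Matrix.zero_apply] at key
  have hc : O ![e, e] ![e, e] = 0 := by
    have h := key ![e, e] ![e, e]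
    simp only [cons_val_zero, cons_val_one, and_self, if_true, mul_one] at h
    have hK : ((K : ℂ) + 3) ≠ 0 := by exact_mod_cast (Nat.succ_ne_zero (K + 2))
    exact (mul_eq_zero.mp (by linear_combination -h)).resolve_left hK
  simp only [hc, zero_mul, mul_zero, add_zero] at key
  have hLR (a b : Fin d) : O ![e, a] ![e, b] = -O ![a, e] ![b, e] := by
    have h := key ![a, e] ![b, e]
    simp only [cons_val_zero, cons_val_one, if_true, mul_one, hc, zero_mul, add_zero] at h
    linear_combination -h
  refine ⟨fun a b => O ![a, e] ![b, e], fun x y => ?_⟩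
  linear_combination -key x y - (if x 1 = y 1 then 1 else 0) * hLR (x 0) (y 0)
end

section
/- Let A : ℝ → Fin d → Matrix (Fin D) (Fin D) ℂ be a time-dependent MPS tensor whose entries are differentiable in t, let h : ℝ → End(ℂ^d ⊗ ℂ^d) be a time-dependent 2-site operator, and let B : ℝ → Fin d → Matrix (Fin D) (Fin D) ℂ. Suppose that for every t ∈ ℝ and all i_1, i_2 ∈ Fin d: Σ_{j_1, j_2 ∈ Fin d} h(t)^{i_1 i_2}_{j_1 j_2} A(t)^{j_1} A(t)^{j_2} − i · (d/dt A(t)^{i_1}) · A(t)^{i_2} = A(t)^{i_1} B(t)^{i_2} − B(t)^{i_1} A(t)^{i_2} (matrix products, i the imaginary unit). Then for every N ≥ 2 and every t, the time-dependent matrix product state ψ_N(t) solves the Schrödinger equation: H_N(t) ψ_N(t) = i · (d/dt) ψ_N(t), where H_N(t) := Σ_{n=1}^N h(t)_n (periodic boundary) and the time derivative of ψ_N(t) is taken coefficientwise. -/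
open Matrix
open scoped ComplexOrder

/-- The product of the matrices `M 0, M 1, …` in increasing order of the index. -/
noncomputable def orderedProd {D m : ℕ} (M : Fin m → Matrix (Fin D) (Fin D) ℂ) :
    Matrix (Fin D) (Fin D) ℂ :=
  (List.ofFn M).prod

lemma orderedProd_succ {D m : ℕ} (M : Fin (m + 1) → Matrix (Fin D) (Fin D) ℂ) :
    orderedProd M = M 0 * orderedProd fun t => M t.succ := by
  simp [orderedProd, List.ofFn_succ]

lemma orderedProd_succ_last {D m : ℕ} (M : Fin (m + 1) → Matrix (Fin D) (Fin D) ℂ) :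
    orderedProd M = (orderedProd fun t => M t.castSucc) * M (Fin.last m) := by
  simp only [orderedProd, List.ofFn_succ', List.concat_eq_append, List.prod_append,
    List.prod_singleton]

lemma trace_orderedProd_one_add {D m : ℕ} (M : Fin (m + 1) → Matrix (Fin D) (Fin D) ℂ) :
    (orderedProd fun t => M (1 + t)).trace = (orderedProd M).trace := by
  rw [orderedProd_succ_last, orderedProd_succ M, Matrix.trace_mul_comm]
  simp only [add_comm (1 : Fin (m + 1)), Fin.last_add_one, Fin.coeSucc_eq_succ]

lemma trace_orderedProd_add {D m : ℕ} (n : Fin (m + 1))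
    (M : Fin (m + 1) → Matrix (Fin D) (Fin D) ℂ) :
    (orderedProd fun t => M (n + t)).trace = (orderedProd M).trace := by
  induction n using Fin.induction with
  | zero => simp
  | succ n ih =>
    rw [← ih, ← trace_orderedProd_one_add fun t => M (n.castSucc + t)]
    simp only [← add_assoc, Fin.coeSucc_eq_succ]

/-- A cyclic trace can be read off starting at any site `n`. -/
lemma trace_orderedProd_eq {D m : ℕ} (n : Fin (m + 2))
    (M : Fin (m + 2) → Matrix (Fin D) (Fin D) ℂ) :
    (orderedProd M).trace =
      (M n * M (n + 1) * orderedProd fun s : Fin m => M (n + s.succ.succ)).trace := by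
  rw [← trace_orderedProd_add n M, orderedProd_succ, orderedProd_succ]
  simp [mul_assoc]

lemma succ_succ_ne_one {m : ℕ} (s : Fin m) : s.succ.succ ≠ (1 : Fin (m + 2)) := by
  rw [← Fin.succ_zero_eq_one, Ne, Fin.succ_inj]
  exact Fin.succ_ne_zero s

lemma trace_orderedProd_update {D m : ℕ} (n : Fin (m + 2))
    (M : Fin (m + 2) → Matrix (Fin D) (Fin D) ℂ) (P : Matrix (Fin D) (Fin D) ℂ) :
    (orderedProd (Function.update M n P)).trace =
      (P * M (n + 1) * orderedProd fun s : Fin m => M (n + s.succ.succ)).trace := by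
  rw [trace_orderedProd_eq n]
  simp

lemma trace_orderedProd_update_add_one {D m : ℕ} (n : Fin (m + 2))
    (M : Fin (m + 2) → Matrix (Fin D) (Fin D) ℂ) (P : Matrix (Fin D) (Fin D) ℂ) :
    (orderedProd (Function.update M (n + 1) P)).trace =
      (M n * P * orderedProd fun s : Fin m => M (n + s.succ.succ)).trace := by
  rw [trace_orderedProd_eq n]
  simp [succ_succ_ne_one]

/-- Leibniz rule for ordered matrix products, entrywise. -/
lemma hasDerivAt_orderedProd {D m : ℕ} {M : ℝ → Fin m → Matrix (Fin D) (Fin D) ℂ}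
    {M' : Fin m → Matrix (Fin D) (Fin D) ℂ} {t : ℝ}
    (hM : ∀ i α β, HasDerivAt (fun s => M s i α β) (M' i α β) t) (α β : Fin D) :
    HasDerivAt (fun s => orderedProd (M s) α β)
      ((∑ n, orderedProd (Function.update (M t) n (M' n))) α β) t := by
  induction m generalizing α β with
  | zero => simpa [orderedProd] using hasDerivAt_const t ((1 : Matrix (Fin D) (Fin D) ℂ) α β)
  | succ m ih =>
    have key := HasDerivAt.fun_sum fun γ (_ : γ ∈ Finset.univ) =>
      (hM 0 α γ).mul (ih (M := fun s i => M s i.succ) (M' := fun i => M' i.succ)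
        (fun i => hM i.succ) γ β)
    simp only [orderedProd_succ, Matrix.mul_apply]
    refine key.congr_deriv ?_
    have hupd (n : Fin m) : (fun k : Fin m => Function.update (M t) n.succ (M' n.succ) k.succ) =
        Function.update (fun k : Fin m => M t k.succ) n (M' n.succ) := by
      funext k
      simp [Function.update_apply]
    have hne (n : Fin m) : (0 : Fin (m + 1)) ≠ n.succ := (Fin.succ_ne_zero n).symm
    simp only [Fin.sum_univ_succ, Matrix.add_apply, Function.update_self, ne_eq,
      Fin.succ_ne_zero, not_false_eq_true, Function.update_of_ne, hupd, hne,
      ← Finset.mul_sum, Finset.sum_add_distrib, Matrix.mul_apply]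

lemma hasDerivAt_trace_orderedProd {D m : ℕ} {M : ℝ → Fin m → Matrix (Fin D) (Fin D) ℂ}
    {M' : Fin m → Matrix (Fin D) (Fin D) ℂ} {t : ℝ}
    (hM : ∀ i α β, HasDerivAt (fun s => M s i α β) (M' i α β) t) :
    HasDerivAt (fun s => (orderedProd (M s)).trace)
      (∑ n, (orderedProd (Function.update (M t) n (M' n))).trace) t := by
  rw [← Matrix.trace_sum]
  exact HasDerivAt.fun_sum fun α _ => hasDerivAt_orderedProd hM α α

lemma cyc_eq_add {m : ℕ} (n t : Fin (m + 1)) : cyc n t.val = n + t := rfl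

/-- A sum over configurations of a periodic chain, with the sites `n` and `n + 1` singled out. -/
lemma sum_config_eq {d m : ℕ} (n : Fin (m + 2)) (F : (Fin (m + 2) → Fin d) → ℂ) :
    ∑ y, F y = ∑ a, ∑ b, ∑ w : Fin m → Fin d,
      F fun k => (Fin.cons a (Fin.cons b w : Fin (m + 1) → Fin d) : Fin (m + 2) → Fin d)
        (k - n) := by
  rw [← (Equiv.arrowCongr (Equiv.addRight n) (Equiv.refl (Fin d))).sum_comp,
    ← (Fin.consEquiv fun _ : Fin (m + 2) => Fin d).sum_comp, Fintype.sum_prod_type]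
  refine Finset.sum_congr rfl fun a _ => ?_
  rw [← (Fin.consEquiv fun _ : Fin (m + 1) => Fin d).sum_comp, Fintype.sum_prod_type]
  refine Finset.sum_congr rfl fun b _ => Finset.sum_congr rfl fun w _ => congrArg F ?_
  funext k
  simp [Equiv.arrowCongr, Fin.consEquiv, sub_eq_add_neg]

lemma localOp_mulVec_mps {d D m : ℕ} (A : Fin d → Matrix (Fin D) (Fin D) ℂ)
    (o : Matrix (Fin 2 → Fin d) (Fin 2 → Fin d) ℂ) (n : Fin (m + 2))
    (x : Fin (m + 2) → Fin d) :
    (localOp o n).mulVec (mps A (m + 2)) x =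
      ((∑ a, ∑ b, o ![x n, x (n + 1)] ![a, b] • (A a * A b)) *
        orderedProd fun s : Fin m => A (x (n + s.succ.succ))).trace := by
  have hc0 : cyc n 0 = n := (cyc_eq_add n 0).trans (add_zero n)
  have hc1 : cyc n 1 = n + 1 := cyc_eq_add n 1
  have hpair (y : Fin (m + 2) → Fin d) :
      (fun t : Fin 2 => y (cyc n t.val)) = ![y n, y (n + 1)] := by
    funext t
    fin_cases t <;> simp [hc0, hc1]
  have hcond (y : Fin (m + 2) → Fin d) :
      (∀ k, (∀ t : Fin 2, k ≠ cyc n t.val) → x k = y k) ↔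
        (fun s : Fin m => x (n + s.succ.succ)) = fun s => y (n + s.succ.succ) := by
    rw [funext_iff]
    constructor
    · intro H s
      refine H _ fun t => ?_
      fin_cases t <;> simp [hc0, hc1, succ_succ_ne_one]
    · intro H k hk
      have h0 : k ≠ n := by simpa [hc0] using hk 0
      have h1 : k ≠ n + 1 := by simpa [hc1] using hk 1
      obtain ⟨j, rfl⟩ : ∃ j, k = n + j := ⟨k - n, by simp⟩
      obtain ⟨i, rfl⟩ := Fin.exists_succ_eq.mpr (fun hj : j = 0 => h0 (by simp [hj]))
      obtain ⟨s, rfl⟩ := Fin.exists_succ_eq.mpr (fun hi : i = 0 => h1 (by simp [hi]))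
      exact H s
  have hmps (y : Fin (m + 2) → Fin d) : mps A (m + 2) y = (A (y n) * A (y (n + 1)) *
      orderedProd fun s : Fin m => A (y (n + s.succ.succ))).trace :=
    trace_orderedProd_eq n fun t => A (y t)
  have hone (a b : Fin d) (w : Fin m → Fin d) :
      (Fin.cons a (Fin.cons b w : Fin (m + 1) → Fin d) : Fin (m + 2) → Fin d) 1 = b := rfl
  simp only [Matrix.mulVec, dotProduct, localOp, Matrix.of_apply, hpair, hcond, hmps]
  rw [sum_config_eq n]
  simp [hone, Finset.sum_mul, Matrix.trace_sum, mul_assoc]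

/-- If the time-dependent local equation
`Σ_j h(t)^{i_1 i_2}_{j_1 j_2} A(t)^{j_1} A(t)^{j_2} − i (∂_t A(t)^{i_1}) A(t)^{i_2}
 = A(t)^{i_1} B(t)^{i_2} − B(t)^{i_1} A(t)^{i_2}` holds for all `t`, then for every
`N ≥ 2` and every `t` the MPS of `A(t)` solves the Schrödinger equation
`H_N(t) ψ_N(t) = i ∂_t ψ_N(t)` (coefficientwise derivative). -/
theorem mps_solves_schroedinger
    (d D : ℕ) (hd : 1 ≤ d) (hD : 1 ≤ D)
    (A : ℝ → Fin d → Matrix (Fin D) (Fin D) ℂ)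
    (hdiff : ∀ (i : Fin d) (α β : Fin D), Differentiable ℝ fun t => A t i α β)
    (h : ℝ → Matrix (Fin 2 → Fin d) (Fin 2 → Fin d) ℂ)
    (B : ℝ → Fin d → Matrix (Fin D) (Fin D) ℂ)
    (hloc : ∀ (t : ℝ) (i1 i2 : Fin d),
      (∑ j1 : Fin d, ∑ j2 : Fin d, h t ![i1, i2] ![j1, j2] • (A t j1 * A t j2))
          - Complex.I •
            ((Matrix.of fun α β => deriv (fun s => A s i1 α β) t) * A t i2)
        = A t i1 * B t i2 - B t i1 * A t i2) :
    ∀ N : ℕ, 2 ≤ N → ∀ t : ℝ,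
      (opSum (N := N) (h t)).mulVec (mps (A t) N)
        = fun i => Complex.I * deriv (fun s => mps (A s) N i) t := by
  intro N hN t
  obtain ⟨m, rfl⟩ := Nat.exists_eq_add_of_le' hN
  funext x
  set M : Fin (m + 2) → Matrix (Fin D) (Fin D) ℂ := fun k => A t (x k) with hMdef
  set M' : Fin (m + 2) → Matrix (Fin D) (Fin D) ℂ :=
    fun k => Matrix.of fun α β => deriv (fun s => A s (x k) α β) t with hM'def
  have hderiv : HasDerivAt (fun s => mps (A s) (m + 2) x)
      (∑ n, (orderedProd (Function.update M n (M' n))).trace) t :=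
    hasDerivAt_trace_orderedProd (M := fun s k => A s (x k))
      fun k α β => (hdiff (x k) α β t).hasDerivAt
  have hterm (n : Fin (m + 2)) : (localOp (h t) n).mulVec (mps (A t) (m + 2)) x =
      Complex.I * (orderedProd (Function.update M n (M' n))).trace +
        ((orderedProd (Function.update M (n + 1) (B t (x (n + 1))))).trace -
          (orderedProd (Function.update M n (B t (x n)))).trace) := by
    rw [localOp_mulVec_mps, sub_eq_iff_eq_add'.mp (hloc t (x n) (x (n + 1))),
      trace_orderedProd_update_add_one, trace_orderedProd_update, trace_orderedProd_update]
    simp only [add_mul, sub_mul, smul_mul_assoc, Matrix.trace_add, Matrix.trace_sub,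
      Matrix.trace_smul, smul_eq_mul, hMdef, hM'def]
  have hshift := Equiv.sum_comp (Equiv.addRight (1 : Fin (m + 2)))
    fun n => (orderedProd (Function.update M n (B t (x n)))).trace
  simp only [Equiv.coe_addRight] at hshift
  rw [hderiv.deriv, opSum, Matrix.sum_mulVec, Finset.sum_apply]
  simp only [hterm, Finset.sum_add_distrib, Finset.sum_sub_distrib, hshift, sub_self, add_zero,
    Finset.mul_sum]
end
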